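/- arXiv:0706.1109 — 8 statements merged into one kernel-verified Lean document; each statement's English description precedes it below -/
import Mathlib

section
/- Let a, z, r be real numbers and ζ = x+iy a complex number with r ≠ 0, z + r ≠ 0, z − r ≠ 0, and (x²+y²)/(r²+a²) + z²/r² = 1. Then Y₁ = rζ/((z+r)(r−ia)) and Y₂ = rζ/((z−r)(r+ia)) both satisfy the quadratic equation Y²·conj(ζ) + 2(z−ia)·Y − ζ = 0. Moreover, replacing r by −r interchanges the two roots: Y₁ evaluated at −r equals Y₂ evaluated at r, and vice versa. -/
open Complex

/-- The first root `Y₁ = rζ/((z+r)(r−ia))` of the Kerr congruence equation. -/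
noncomputable def KerrY₁ (a z r x y : ℝ) : ℂ :=
  (r : ℂ) * ((x : ℂ) + (y : ℂ) * Complex.I) /
    (((z : ℂ) + (r : ℂ)) * ((r : ℂ) - (a : ℂ) * Complex.I))

/-- The second root `Y₂ = rζ/((z−r)(r+ia))` of the Kerr congruence equation. -/
noncomputable def KerrY₂ (a z r x y : ℝ) : ℂ :=
  (r : ℂ) * ((x : ℂ) + (y : ℂ) * Complex.I) /
    (((z : ℂ) - (r : ℂ)) * ((r : ℂ) + (a : ℂ) * Complex.I))

theorem kerr_aux (a z r x y : ℝ) (hr : r ≠ 0) (h1 : z + r ≠ 0)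
    (hell : (x ^ 2 + y ^ 2) / (r ^ 2 + a ^ 2) + z ^ 2 / r ^ 2 = 1) :
    KerrY₁ a z r x y ^ 2 * (starRingEnd ℂ) ((x : ℂ) + (y : ℂ) * Complex.I) +
        2 * ((z : ℂ) - (a : ℂ) * Complex.I) * KerrY₁ a z r x y -
        ((x : ℂ) + (y : ℂ) * Complex.I) = 0 := by
  have hp : r ^ 2 + a ^ 2 ≠ 0 := by positivity
  have h : (x ^ 2 + y ^ 2) * r ^ 2 = (r ^ 2 - z ^ 2) * (r ^ 2 + a ^ 2) := by
    field_simp at hell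
    linarith
  have hc : ((x : ℂ) ^ 2 + (y : ℂ) ^ 2) * (r : ℂ) ^ 2 =
      ((r : ℂ) ^ 2 - (z : ℂ) ^ 2) * ((r : ℂ) ^ 2 + (a : ℂ) ^ 2) := by
    exact_mod_cast h
  have hz : (z : ℂ) + (r : ℂ) ≠ 0 := by exact_mod_cast h1
  have hra : (r : ℂ) - (a : ℂ) * Complex.I ≠ 0 := by
    intro h0
    apply hr
    simpa using congrArg Complex.re h0
  have hI : Complex.I ^ 2 = -1 := Complex.I_sq
  have hconj : (starRingEnd ℂ) ((x : ℂ) + (y : ℂ) * Complex.I) = (x : ℂ) - (y : ℂ) * Complex.I := by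
    simp [sub_eq_add_neg]
  rw [hconj]
  unfold KerrY₁
  have hD := mul_ne_zero hz hra
  have key : ((r : ℂ) * ((x : ℂ) + (y : ℂ) * Complex.I)) ^ 2 * ((x : ℂ) - (y : ℂ) * Complex.I) +
      2 * ((z : ℂ) - (a : ℂ) * Complex.I) * ((r : ℂ) * ((x : ℂ) + (y : ℂ) * Complex.I)) *
        (((z : ℂ) + (r : ℂ)) * ((r : ℂ) - (a : ℂ) * Complex.I)) -
      ((x : ℂ) + (y : ℂ) * Complex.I) *
        (((z : ℂ) + (r : ℂ)) * ((r : ℂ) - (a : ℂ) * Complex.I)) ^ 2 = 0 := by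
    linear_combination ((x : ℂ) + (y : ℂ) * Complex.I) * hc +
      ((x : ℂ) + (y : ℂ) * Complex.I) *
        (-(r : ℂ) ^ 2 * (y : ℂ) ^ 2 + ((r : ℂ) ^ 2 - (z : ℂ) ^ 2) * (-(a : ℂ) ^ 2) * (-1)) * hI
  generalize ((z : ℂ) + (r : ℂ)) * ((r : ℂ) - (a : ℂ) * Complex.I) = D at *
  generalize (r : ℂ) * ((x : ℂ) + (y : ℂ) * Complex.I) = N at *
  generalize (x : ℂ) + (y : ℂ) * Complex.I = w at *
  generalize (x : ℂ) - (y : ℂ) * Complex.I = v at *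
  generalize (z : ℂ) - (a : ℂ) * Complex.I = u at *
  field_simp
  linear_combination key

theorem kerr_swap (a z r x y : ℝ) : KerrY₁ a z (-r) x y = KerrY₂ a z r x y := by
  unfold KerrY₁ KerrY₂
  push_cast
  rw [← neg_div_neg_eq]
  congr 1 <;> ring

/-- If `r ≠ 0`, `z+r ≠ 0`, `z−r ≠ 0` and
`(x²+y²)/(r²+a²) + z²/r² = 1`, then `Y₁` and `Y₂` both satisfy the quadratic
`Y²·conj ζ + 2(z−ia)Y − ζ = 0` (with `ζ = x+iy`), and replacing `r` by `−r`
interchanges the two roots. -/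
theorem stmt_2 (a z r x y : ℝ) (hr : r ≠ 0) (h1 : z + r ≠ 0) (h2 : z - r ≠ 0)
    (hell : (x ^ 2 + y ^ 2) / (r ^ 2 + a ^ 2) + z ^ 2 / r ^ 2 = 1) :
    (KerrY₁ a z r x y ^ 2 * (starRingEnd ℂ) ((x : ℂ) + (y : ℂ) * Complex.I) +
        2 * ((z : ℂ) - (a : ℂ) * Complex.I) * KerrY₁ a z r x y -
        ((x : ℂ) + (y : ℂ) * Complex.I) = 0) ∧
    (KerrY₂ a z r x y ^ 2 * (starRingEnd ℂ) ((x : ℂ) + (y : ℂ) * Complex.I) +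
        2 * ((z : ℂ) - (a : ℂ) * Complex.I) * KerrY₂ a z r x y -
        ((x : ℂ) + (y : ℂ) * Complex.I) = 0) ∧
    KerrY₁ a z (-r) x y = KerrY₂ a z r x y ∧
    KerrY₂ a z (-r) x y = KerrY₁ a z r x y := by
  have hs : KerrY₂ a z (-r) x y = KerrY₁ a z r x y := by
    rw [← kerr_swap, neg_neg]
  refine ⟨kerr_aux a z r x y hr h1 hell, ?_, kerr_swap a z r x y, hs⟩
  rw [← kerr_swap]
  exact kerr_aux a z (-r) x y (neg_ne_zero.mpr hr) (by simpa [sub_eq_add_neg] using h2)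
    (by simpa using hell)
end

section
/- Let a, z, r be real numbers and ζ = x+iy a complex number with r ≠ 0, z + r ≠ 0, and (x²+y²)/(r²+a²) + z²/r² = 1, and let Y₁ = rζ/((z+r)(r−ia)). Then Y₁·conj(ζ) + z − ia = (r² − iaz)/r. Consequently, if in addition r⁴ + a²z² ≠ 0, then 2·(2Y₁·conj(ζ) + 2z − 2ia)⁻¹ = (r³ + iarz)/(r⁴ + a²z²); this is the closed form 2Y_{,ζ} = (r³+iarz)/(r⁴+a²z²) for the ζ-derivative of Y along the Kerr congruence. -/
open Complex

/-- With `r ≠ 0`, `z+r ≠ 0` and `(x²+y²)/(r²+a²) + z²/r² = 1`,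
one has `Y₁·conj ζ + z − ia = (r² − iaz)/r`; consequently, if moreover
`r⁴ + a²z² ≠ 0`, then `2·(2Y₁·conj ζ + 2z − 2ia)⁻¹ = (r³+iarz)/(r⁴+a²z²)`,
the closed form for `2Y_{,ζ}` along the Kerr congruence. -/
theorem stmt_3 (a z r x y : ℝ) (hr : r ≠ 0) (h1 : z + r ≠ 0)
    (hell : (x ^ 2 + y ^ 2) / (r ^ 2 + a ^ 2) + z ^ 2 / r ^ 2 = 1) :
    KerrY₁ a z r x y * (starRingEnd ℂ) ((x : ℂ) + (y : ℂ) * Complex.I) +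
        (z : ℂ) - (a : ℂ) * Complex.I =
      ((r : ℂ) ^ 2 - (a : ℂ) * (z : ℂ) * Complex.I) / (r : ℂ) ∧
    (r ^ 4 + a ^ 2 * z ^ 2 ≠ 0 →
      2 * (2 * KerrY₁ a z r x y * (starRingEnd ℂ) ((x : ℂ) + (y : ℂ) * Complex.I) +
            2 * (z : ℂ) - 2 * (a : ℂ) * Complex.I)⁻¹ =
        ((r : ℂ) ^ 3 + (a : ℂ) * (r : ℂ) * (z : ℂ) * Complex.I) /
          ((r : ℂ) ^ 4 + (a : ℂ) ^ 2 * (z : ℂ) ^ 2)) := by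
  have hra : r ^ 2 + a ^ 2 ≠ 0 := by positivity
  have hreal : r ^ 2 * (x ^ 2 + y ^ 2) = (r ^ 2 - z ^ 2) * (r ^ 2 + a ^ 2) := by
    field_simp at hell
    linear_combination hell
  have hc : (r : ℂ) ^ 2 * ((x : ℂ) ^ 2 + (y : ℂ) ^ 2) =
      ((r : ℂ) ^ 2 - (z : ℂ) ^ 2) * ((r : ℂ) ^ 2 + (a : ℂ) ^ 2) := by
    exact_mod_cast hreal
  have hrc : (r : ℂ) ≠ 0 := by exact_mod_cast hr
  have hzr : (z : ℂ) + (r : ℂ) ≠ 0 := by exact_mod_cast h1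
  have hria : (r : ℂ) - (a : ℂ) * Complex.I ≠ 0 := by
    intro h
    apply hr
    simpa using congrArg Complex.re h
  have hI : Complex.I ^ 2 + 1 = 0 := by simp
  have hconj : (starRingEnd ℂ) ((x : ℂ) + (y : ℂ) * Complex.I) =
      (x : ℂ) - (y : ℂ) * Complex.I := by
    simp [sub_eq_add_neg]
  have hY : KerrY₁ a z r x y * (starRingEnd ℂ) ((x : ℂ) + (y : ℂ) * Complex.I) =
      ((r : ℂ) + (a : ℂ) * Complex.I) * ((r : ℂ) - (z : ℂ)) / (r : ℂ) := by
    rw [hconj, KerrY₁, div_mul_eq_mul_div, div_eq_div_iff (mul_ne_zero hzr hria) hrc]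
    linear_combination hc +
      (-(r : ℂ) ^ 2 * (y : ℂ) ^ 2 + ((r : ℂ) ^ 2 - (z : ℂ) ^ 2) * (a : ℂ) ^ 2) * hI
  have hfirst : KerrY₁ a z r x y * (starRingEnd ℂ) ((x : ℂ) + (y : ℂ) * Complex.I) +
        (z : ℂ) - (a : ℂ) * Complex.I =
      ((r : ℂ) ^ 2 - (a : ℂ) * (z : ℂ) * Complex.I) / (r : ℂ) := by
    rw [hY]
    field_simp
    ring
  refine ⟨hfirst, fun h4 => ?_⟩
  have h4c : (r : ℂ) ^ 4 + (a : ℂ) ^ 2 * (z : ℂ) ^ 2 ≠ 0 := by exact_mod_cast h4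
  have hfac : ((r : ℂ) ^ 2 - (a : ℂ) * (z : ℂ) * Complex.I) *
      ((r : ℂ) ^ 2 + (a : ℂ) * (z : ℂ) * Complex.I) =
      (r : ℂ) ^ 4 + (a : ℂ) ^ 2 * (z : ℂ) ^ 2 := by
    linear_combination (-(a : ℂ) ^ 2 * (z : ℂ) ^ 2) * hI
  have hm : (r : ℂ) ^ 2 - (a : ℂ) * (z : ℂ) * Complex.I ≠ 0 := by
    intro h
    apply h4c
    rw [← hfac, h, zero_mul]
  have h2 : 2 * KerrY₁ a z r x y * (starRingEnd ℂ) ((x : ℂ) + (y : ℂ) * Complex.I) +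
      2 * (z : ℂ) - 2 * (a : ℂ) * Complex.I =
      2 * (((r : ℂ) ^ 2 - (a : ℂ) * (z : ℂ) * Complex.I) / (r : ℂ)) := by
    rw [← hfirst]
    ring
  rw [h2, mul_inv, inv_div, mul_inv_cancel_left₀ two_ne_zero, div_eq_div_iff hm h4c, ← hfac]
  ring
end

section
/- Let φ : ℂ → ℂ be holomorphic, let U ⊆ ℝ³ be open, and let Y : U → ℂ be differentiable (as a map from ℝ³ to ℂ ≅ ℝ²) such that Y(x,y,z)²·(x−iy) + 2z·Y(x,y,z) − (x+iy) + φ(Y(x,y,z)) = 0 for all (x,y,z) ∈ U. Then at every point p ∈ U where 2Y(p)·(x−iy) + 2z + φ′(Y(p)) ≠ 0, the Wirtinger derivative ∂Y/∂ζ := (1/2)(∂Y/∂x − i·∂Y/∂y) satisfies ∂Y/∂ζ = (2Y·(x−iy) + 2z + φ′(Y))⁻¹ at p. -/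
open Complex

/-- Let `φ : ℂ → ℂ` be holomorphic, `U ⊆ ℝ³` open, and
`Y : U → ℂ` (real-)differentiable satisfying
`Y²·(x−iy) + 2zY − (x+iy) + φ(Y) = 0` on `U`.  At every `p ∈ U` where
`2Y·(x−iy) + 2z + φ′(Y) ≠ 0`, the Wirtinger derivative
`∂Y/∂ζ = (1/2)(∂Y/∂x − i·∂Y/∂y)` equals `(2Y·(x−iy) + 2z + φ′(Y))⁻¹`. -/
theorem stmt_4 (φ : ℂ → ℂ) (hφ : Differentiable ℂ φ)
    (U : Set (ℝ × ℝ × ℝ)) (hU : IsOpen U) (Y : ℝ × ℝ × ℝ → ℂ)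
    (hY : ∀ p ∈ U, DifferentiableAt ℝ Y p)
    (heq : ∀ p ∈ U,
      Y p ^ 2 * ((p.1 : ℂ) - (p.2.1 : ℂ) * Complex.I) + 2 * (p.2.2 : ℂ) * Y p -
        ((p.1 : ℂ) + (p.2.1 : ℂ) * Complex.I) + φ (Y p) = 0)
    (p : ℝ × ℝ × ℝ) (hp : p ∈ U)
    (hnz : 2 * Y p * ((p.1 : ℂ) - (p.2.1 : ℂ) * Complex.I) + 2 * (p.2.2 : ℂ) +
        deriv φ (Y p) ≠ 0) :
    (1 / 2 : ℂ) * (fderiv ℝ Y p (1, 0, 0) - Complex.I * fderiv ℝ Y p (0, 1, 0)) =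
      (2 * Y p * ((p.1 : ℂ) - (p.2.1 : ℂ) * Complex.I) + 2 * (p.2.2 : ℂ) +
        deriv φ (Y p))⁻¹ := by
  have key : ∀ a b : ℝ, fderiv ℝ Y p (a, b, 0) *
      (2 * Y p * ((p.1 : ℂ) - (p.2.1 : ℂ) * Complex.I) + 2 * (p.2.2 : ℂ) + deriv φ (Y p)) +
      Y p ^ 2 * ((a : ℂ) - (b : ℂ) * Complex.I) - ((a : ℂ) + (b : ℂ) * Complex.I) = 0 := by
    intro a b
    have hc : HasDerivAt (fun t : ℝ => p + t • ((a, b, 0) : ℝ × ℝ × ℝ)) (a, b, 0) 0 := by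
      simpa using ((hasDerivAt_id (0 : ℝ)).smul_const ((a, b, 0) : ℝ × ℝ × ℝ)).const_add p
    have h0 : p + (0 : ℝ) • ((a, b, 0) : ℝ × ℝ × ℝ) = p := by simp
    have hg : HasDerivAt (fun t : ℝ => Y (p + t • ((a, b, 0) : ℝ × ℝ × ℝ)))
        (fderiv ℝ Y p (a, b, 0)) 0 :=
      HasFDerivAt.comp_hasDerivAt (0 : ℝ) (by rw [h0]; exact (hY p hp).hasFDerivAt) hc
    have hφg : HasDerivAt (fun t : ℝ => φ (Y (p + t • ((a, b, 0) : ℝ × ℝ × ℝ))))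
        (deriv φ (Y p) * fderiv ℝ Y p (a, b, 0)) 0 :=
      HasDerivAt.comp (0 : ℝ) (h₂ := φ) (by rw [h0]; exact (hφ (Y p)).hasDerivAt) hg
    have hlin : ∀ u v : ℝ, HasDerivAt (fun t : ℝ => ((u + t * v : ℝ) : ℂ)) (v : ℂ) 0 := by
      intro u v
      have := (((hasDerivAt_id (0 : ℝ)).mul_const v).const_add u).ofReal_comp
      simpa using this
    have hx := hlin p.1 a
    have hy := (hlin p.2.1 b).mul_const Complex.I
    have hF := ((((hg.pow 2).mul (hx.sub hy)).add (hg.const_mul (2 * (p.2.2 : ℂ)))).sub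
      (hx.add hy)).add hφg
    have hev : ∀ᶠ t : ℝ in nhds 0, p + t • ((a, b, 0) : ℝ × ℝ × ℝ) ∈ U := by
      apply hc.continuousAt.eventually_mem
      rw [h0]; exact hU.mem_nhds hp
    have hz := (hF.congr_of_eventuallyEq (f₁ := fun _ => (0 : ℂ)) (by
      filter_upwards [hev] with t ht
      have := heq _ ht
      simp at this ⊢
      exact this.symm)).unique (hasDerivAt_const (0 : ℝ) (0 : ℂ))
    have h00 : p + ((0, 0, 0) : ℝ × ℝ × ℝ) = p := add_zero p
    simp [h00] at hz
    linear_combination hz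
  have h1 := key 1 0
  have h2 := key 0 1
  push_cast at h1 h2
  apply eq_inv_of_mul_eq_one_left
  linear_combination (1 / 2 : ℂ) * h1 - (1 / 2 : ℂ) * Complex.I * h2 -
    (1 / 2 : ℂ) * (Y p ^ 2 + 1) * Complex.I_sq
end

section
/- Fix a real number a and define Φ : ℝ⁴ → ℝ⁴ by Φ(r,θ,φ,u) = (x,y,z,t) where x + iy = (r+ia)·e^{iφ}·sin θ, z = r·cos θ, and t = −(r+u). Then for every point (r,θ,φ,u) and every tangent vector with components (dr,dθ,dφ,du) ∈ ℝ⁴, the image components (dx,dy,dz,dt) under the derivative of Φ satisfy dx² + dy² + dz² − dt² = (r² + a²cos²θ)(dθ² + sin²θ·dφ²) − (2dr + du − a·sin²θ·dφ)(du + a·sin²θ·dφ). In other words, the base metric ds₀² of the original 1963 form of the Kerr metric is flat: it is the pullback of the Minkowski metric under Φ. -/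
/-- The 1963 → Kerr–Schild coordinate transformation `Φ(r,θ,φ,u) = (x,y,z,t)`
with `x+iy = (r+ia)e^{iφ} sin θ`, `z = r cos θ`, `t = −(r+u)`. -/
noncomputable def KerrPhi (a : ℝ) (p : ℝ × ℝ × ℝ × ℝ) : ℝ × ℝ × ℝ × ℝ :=
  (((((p.1 : ℂ) + (a : ℂ) * Complex.I) * Complex.exp ((p.2.2.1 : ℂ) * Complex.I)) *
      (Real.sin p.2.1 : ℂ)).re,
   ((((p.1 : ℂ) + (a : ℂ) * Complex.I) * Complex.exp ((p.2.2.1 : ℂ) * Complex.I)) *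
      (Real.sin p.2.1 : ℂ)).im,
   p.1 * Real.cos p.2.1,
   -(p.1 + p.2.2.2))

/-- `KerrPhi` in real form. -/
theorem KerrPhi_real (a : ℝ) : KerrPhi a = fun p : ℝ × ℝ × ℝ × ℝ =>
    ((p.1 * Real.cos p.2.2.1 - a * Real.sin p.2.2.1) * Real.sin p.2.1,
     (p.1 * Real.sin p.2.2.1 + a * Real.cos p.2.2.1) * Real.sin p.2.1,
     p.1 * Real.cos p.2.1, -(p.1 + p.2.2.2)) := by
  funext p
  simp only [KerrPhi, Prod.mk.injEq, and_true]
  constructor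
  · rw [Complex.re_mul_ofReal]
    simp [Complex.exp_ofReal_mul_I_re, Complex.exp_ofReal_mul_I_im]
  · rw [Complex.im_mul_ofReal]
    simp [Complex.exp_ofReal_mul_I_re, Complex.exp_ofReal_mul_I_im]

/-- For every point `p = (r,θ,φ,u)` and tangent vector
`v = (dr,dθ,dφ,du)`, the image components `(dx,dy,dz,dt)` under the derivative
of `Φ` satisfy `dx²+dy²+dz²−dt² =
(r²+a²cos²θ)(dθ²+sin²θ dφ²) − (2dr+du−a sin²θ dφ)(du+a sin²θ dφ)`:
the base metric of the original 1963 form of the Kerr metric is the pullback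
of the Minkowski metric, i.e. flat. -/
theorem stmt_6 (a : ℝ) (p v : ℝ × ℝ × ℝ × ℝ) :
    (fderiv ℝ (KerrPhi a) p v).1 ^ 2 + (fderiv ℝ (KerrPhi a) p v).2.1 ^ 2 +
        (fderiv ℝ (KerrPhi a) p v).2.2.1 ^ 2 - (fderiv ℝ (KerrPhi a) p v).2.2.2 ^ 2 =
      (p.1 ^ 2 + a ^ 2 * Real.cos p.2.1 ^ 2) *
          (v.2.1 ^ 2 + Real.sin p.2.1 ^ 2 * v.2.2.1 ^ 2) -
        (2 * v.1 + v.2.2.2 - a * Real.sin p.2.1 ^ 2 * v.2.2.1) *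
          (v.2.2.2 + a * Real.sin p.2.1 ^ 2 * v.2.2.1) := by
  have h1 : HasFDerivAt (fun q : ℝ × ℝ × ℝ × ℝ => q.1) (ContinuousLinearMap.fst ℝ ℝ (ℝ × ℝ × ℝ)) p :=
    hasFDerivAt_fst
  have h' : HasFDerivAt (fun q : ℝ × ℝ × ℝ × ℝ => q.2) (ContinuousLinearMap.snd ℝ ℝ (ℝ × ℝ × ℝ)) p :=
    hasFDerivAt_snd
  have h2 := h'.fst
  have h3 := h'.snd.fst
  have h4 := h'.snd.snd
  have H := ((((h1.mul h3.cos).sub (h3.sin.const_mul a)).mul h2.sin).prodMk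
    ((((h1.mul h3.sin).add (h3.cos.const_mul a)).mul h2.sin).prodMk
      ((h1.mul h2.cos).prodMk (h1.add h4).neg)))
  have E : fderiv ℝ (KerrPhi a) p = _ :=
    (congrArg (fun f => fderiv ℝ f p) (KerrPhi_real a)).trans H.fderiv
  rw [E]
  clear E H h4 h3 h2 h' h1
  obtain ⟨r, θ, φ, u⟩ := p
  obtain ⟨dr, dθ, dφ, du⟩ := v
  simp
  have e1 := Real.sin_sq_add_cos_sq θ
  have e2 := Real.sin_sq_add_cos_sq φ
  generalize Real.sin θ = s at *
  generalize Real.cos θ = c at *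
  generalize Real.sin φ = S at *
  generalize Real.cos φ = C at *
  have e3 : c ^ 2 = 1 - s ^ 2 := by linarith
  have e4 : C ^ 2 = 1 - S ^ 2 := by linarith
  grind
end

section
/- Fix real numbers m and a and define Φ : ℝ⁴ → ℝ⁴ by Φ(r,θ,φ,u) = (x,y,z,t) where x + iy = (r+ia)·e^{iφ}·sin θ, z = r·cos θ, and t = −(r+u). At every point with r ≠ 0, r² + a² ≠ 0 and r² + a²cos²θ ≠ 0, the pullback under Φ of the Kerr–Schild quadratic form dx² + dy² + dz² − dt² + (2mr³/(r⁴ + a²z²))·k², where k = dt + (z/r)dz + (r/(r²+a²))(xdx+ydy) − (a/(r²+a²))(xdy−ydx), equals (r²+a²cos²θ)(dθ² + sin²θ·dφ²) − (2dr + du − a·sin²θ·dφ)(du + a·sin²θ·dφ) + (2mr/(r²+a²cos²θ))·(du + a·sin²θ·dφ)². That is, the original 1963 form of the Kerr metric and its Kerr–Schild form are the same metric in different coordinates. -/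
theorem KerrPhi_eq (a : ℝ) : KerrPhi a = fun p =>
    ((p.1 * Real.cos p.2.2.1 - a * Real.sin p.2.2.1) * Real.sin p.2.1,
     (p.1 * Real.sin p.2.2.1 + a * Real.cos p.2.2.1) * Real.sin p.2.1,
     p.1 * Real.cos p.2.1,
     -(p.1 + p.2.2.2)) := by
  funext p
  simp only [KerrPhi, Complex.exp_mul_I, ← Complex.ofReal_cos, ← Complex.ofReal_sin]
  simp [-Complex.ofReal_cos, -Complex.ofReal_sin]

theorem KerrPhi_fderiv (a r θ φ u vr vθ vφ vu : ℝ) :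
    fderiv ℝ (KerrPhi a) (r, θ, φ, u) (vr, vθ, vφ, vu) =
    ((vr * Real.cos φ - r * Real.sin φ * vφ - a * Real.cos φ * vφ) * Real.sin θ
        + (r * Real.cos φ - a * Real.sin φ) * Real.cos θ * vθ,
     (vr * Real.sin φ + r * Real.cos φ * vφ - a * Real.sin φ * vφ) * Real.sin θ
        + (r * Real.sin φ + a * Real.cos φ) * Real.cos θ * vθ,
     vr * Real.cos θ - r * Real.sin θ * vθ,
     -(vr + vu)) := by
  rw [KerrPhi_eq]
  have h1 : HasFDerivAt (𝕜 := ℝ) (fun p : ℝ × ℝ × ℝ × ℝ => p.1) _ (r, θ, φ, u) := hasFDerivAt_fst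
  have hsnd : HasFDerivAt (𝕜 := ℝ) (fun p : ℝ × ℝ × ℝ × ℝ => p.2) _ (r, θ, φ, u) := hasFDerivAt_snd
  have h2 := hsnd.fst
  have h3 := hsnd.snd.fst
  have h4 := hsnd.snd.snd
  have H := (((h1.mul h3.cos).sub (h3.sin.const_mul a)).mul h2.sin).prodMk
    ((((h1.mul h3.sin).add (h3.cos.const_mul a)).mul h2.sin).prodMk
      ((h1.mul h2.cos).prodMk (h1.add h4).neg))
  have H2 := H.fderiv
  refine (congrArg (fun L => L (vr, vθ, vφ, vu)) H2).trans ?_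
  simp
  refine ⟨?_, ?_, ?_⟩ <;> ring

/-- At every point `p = (r,θ,φ,u)` with `r ≠ 0`, `r²+a² ≠ 0`, and
`r²+a²cos²θ ≠ 0`, the pullback under `Φ` of the Kerr–Schild quadratic form
`dx²+dy²+dz²−dt² + (2mr³/(r⁴+a²z²))·k²`, where
`k = dt + (z/r)dz + (r/(r²+a²))(x dx + y dy) − (a/(r²+a²))(x dy − y dx)`,
equals the original 1963 form
`(r²+a²cos²θ)(dθ²+sin²θ dφ²) − (2dr+du−a sin²θ dφ)(du+a sin²θ dφ)
 + (2mr/(r²+a²cos²θ))(du+a sin²θ dφ)²`. -/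
theorem stmt_8 (m a : ℝ) (p v : ℝ × ℝ × ℝ × ℝ) (hr : p.1 ≠ 0)
    (hra : p.1 ^ 2 + a ^ 2 ≠ 0)
    (hS : p.1 ^ 2 + a ^ 2 * Real.cos p.2.1 ^ 2 ≠ 0) :
    (let d := fderiv ℝ (KerrPhi a) p v
     let q := KerrPhi a p
     let kv := d.2.2.2 + (q.2.2.1 / p.1) * d.2.2.1 +
       (p.1 / (p.1 ^ 2 + a ^ 2)) * (q.1 * d.1 + q.2.1 * d.2.1) -
       (a / (p.1 ^ 2 + a ^ 2)) * (q.1 * d.2.1 - q.2.1 * d.1)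
     d.1 ^ 2 + d.2.1 ^ 2 + d.2.2.1 ^ 2 - d.2.2.2 ^ 2 +
       (2 * m * p.1 ^ 3 / (p.1 ^ 4 + a ^ 2 * q.2.2.1 ^ 2)) * kv ^ 2) =
      (p.1 ^ 2 + a ^ 2 * Real.cos p.2.1 ^ 2) *
          (v.2.1 ^ 2 + Real.sin p.2.1 ^ 2 * v.2.2.1 ^ 2) -
        (2 * v.1 + v.2.2.2 - a * Real.sin p.2.1 ^ 2 * v.2.2.1) *
          (v.2.2.2 + a * Real.sin p.2.1 ^ 2 * v.2.2.1) +
        (2 * m * p.1 / (p.1 ^ 2 + a ^ 2 * Real.cos p.2.1 ^ 2)) *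
          (v.2.2.2 + a * Real.sin p.2.1 ^ 2 * v.2.2.1) ^ 2 := by
  obtain ⟨r, θ, φ, u⟩ := p
  obtain ⟨vr, vθ, vφ, vu⟩ := v
  rw [KerrPhi_fderiv, KerrPhi_eq]
  dsimp only at hr hra hS ⊢
  have e1 := Real.sin_sq_add_cos_sq θ
  have e2 := Real.sin_sq_add_cos_sq φ
  generalize Real.sin θ = s at *
  generalize Real.cos θ = c at *
  generalize Real.sin φ = S at *
  generalize Real.cos φ = C at *
  set X := (r * C - a * S) * s with hX
  set Y := (r * S + a * C) * s with hY
  set dX := (vr * C - r * S * vφ - a * C * vφ) * s + (r * C - a * S) * c * vθ with hdX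
  set dY := (vr * S + r * C * vφ - a * S * vφ) * s + (r * S + a * C) * c * vθ with hdY
  have f0 : dX ^ 2 + dY ^ 2 = (s * vr + r * c * vθ - a * s * vφ) ^ 2
      + (a * c * vθ + r * s * vφ) ^ 2 := by
    rw [hdX, hdY]
    linear_combination ((s * vr + r * c * vθ - a * s * vφ) ^ 2
      + (a * c * vθ + r * s * vφ) ^ 2) * e2
  have f1 : X * dX + Y * dY = r * s ^ 2 * vr + (r ^ 2 + a ^ 2) * s * c * vθ := by
    rw [hX, hY, hdX, hdY]
    linear_combination (r * s ^ 2 * vr + (r ^ 2 + a ^ 2) * s * c * vθ) * e2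
  have f2 : X * dY - Y * dX = (r ^ 2 + a ^ 2) * s ^ 2 * vφ - a * s ^ 2 * vr := by
    rw [hX, hY, hdX, hdY]
    linear_combination ((r ^ 2 + a ^ 2) * s ^ 2 * vφ - a * s ^ 2 * vr) * e2
  have hk : -(vr + vu) + r * c / r * (vr * c - r * s * vθ)
      + r / (r ^ 2 + a ^ 2) * (X * dX + Y * dY)
      - a / (r ^ 2 + a ^ 2) * (X * dY - Y * dX) = -(vu + a * s ^ 2 * vφ) := by
    rw [f1, f2]
    field_simp
    linear_combination (r ^ 2 + a ^ 2) * vr * e1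
  have hm : 2 * m * r ^ 3 / (r ^ 4 + a ^ 2 * (r * c) ^ 2)
      = 2 * m * r / (r ^ 2 + a ^ 2 * c ^ 2) := by
    have : r ^ 4 + a ^ 2 * (r * c) ^ 2 = r ^ 2 * (r ^ 2 + a ^ 2 * c ^ 2) := by ring
    rw [this]
    field_simp
  rw [hk, hm, f0]
  have hs : c ^ 2 = 1 - s ^ 2 := by linear_combination e1
  have flat : (s * vr + r * c * vθ - a * s * vφ) ^ 2 + (a * c * vθ + r * s * vφ) ^ 2
      + (vr * c - r * s * vθ) ^ 2 - (-(vr + vu)) ^ 2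
      = (r ^ 2 + a ^ 2 * c ^ 2) * (vθ ^ 2 + s ^ 2 * vφ ^ 2)
        - (2 * vr + vu - a * s ^ 2 * vφ) * (vu + a * s ^ 2 * vφ) := by
    ring_nf
    rw [hs]
    ring
  rw [flat]
  ring
end

section
/- Let Z₀ > 0 and M₀ be real numbers. A twice continuously differentiable function Σ : (0,∞) → ℝ satisfies the ordinary differential equation (Z+Z₀)²·(Z·Σ''(Z) + Σ'(Z)) + 2Z₀·Σ(Z) = M₀ for all Z > 0 if and only if there exist real constants C₀, α, C₂ with 2Z₀·C₀ + 4Z₀·C₂ = M₀ such that Σ(Z) = C₀ + ((Z−Z₀)/(Z+Z₀))·(−α + C₂·ln Z) for all Z > 0. In particular, when C₂ = 0 one has M₀ = 2Z₀·C₀, and the constant solutions Σ = C₀ correspond to M₀ = 2Z₀C₀. -/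
lemma aux_f (Z₀ Z : ℝ) (hZ₀ : 0 < Z₀) (hZ : 0 < Z) :
    HasDerivAt (fun Z : ℝ => (Z - Z₀) / (Z + Z₀)) (2 * Z₀ / (Z + Z₀) ^ 2) Z := by
  have hP : Z + Z₀ ≠ 0 := by positivity
  refine HasDerivAt.congr_deriv (((hasDerivAt_id Z).sub_const Z₀).div ((hasDerivAt_id Z).add_const Z₀) hP) ?_
  try simp only [id]
  ring

lemma aux_f2 (Z₀ Z : ℝ) (hZ₀ : 0 < Z₀) (hZ : 0 < Z) :
    HasDerivAt (fun Z : ℝ => 2 * Z₀ / (Z + Z₀) ^ 2) (-4 * Z₀ / (Z + Z₀) ^ 3) Z := by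
  have hP : Z + Z₀ ≠ 0 := by positivity
  refine HasDerivAt.congr_deriv ((hasDerivAt_const Z (2 * Z₀)).div
    (((hasDerivAt_id Z).add_const Z₀).pow 2) (pow_ne_zero 2 hP)) ?_
  try simp only [id, Pi.pow_apply]
  field_simp
  norm_num
  ring

lemma aux_const (A : ℝ → ℝ) (h : ∀ Z > 0, HasDerivAt A 0 Z) :
    ∃ a, ∀ Z > 0, A Z = a := by
  refine ⟨A 1, fun Z hZ => ?_⟩
  refine IsOpen.is_const_of_deriv_eq_zero (s := Set.Ioi (0 : ℝ)) isOpen_Ioi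
    isPreconnected_Ioi (fun x hx => (h x hx).differentiableAt.differentiableWithinAt)
    (fun x hx => (h x hx).deriv) hZ (Set.mem_Ioi.2 one_pos)

/-- For `Z₀ > 0` and `M₀ ∈ ℝ`, a twice continuously
differentiable `Σ : (0,∞) → ℝ` satisfies
`(Z+Z₀)²(ZΣ'' + Σ') + 2Z₀Σ = M₀` on `(0,∞)` if and only if there are constants
`C₀, α, C₂` with `2Z₀C₀ + 4Z₀C₂ = M₀` and
`Σ(Z) = C₀ + ((Z−Z₀)/(Z+Z₀))(−α + C₂ ln Z)` for all `Z > 0`. -/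
theorem stmt_10 (Z₀ M₀ : ℝ) (hZ₀ : 0 < Z₀) (S : ℝ → ℝ)
    (hS : ContDiffOn ℝ 2 S (Set.Ioi (0 : ℝ))) :
    (∀ Z > (0 : ℝ),
        (Z + Z₀) ^ 2 * (Z * deriv (deriv S) Z + deriv S Z) + 2 * Z₀ * S Z = M₀) ↔
      ∃ C₀ α C₂ : ℝ, 2 * Z₀ * C₀ + 4 * Z₀ * C₂ = M₀ ∧
        ∀ Z > (0 : ℝ),
          S Z = C₀ + ((Z - Z₀) / (Z + Z₀)) * (-α + C₂ * Real.log Z) := by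
  constructor
  · intro h
    have hS1 : ∀ Z > 0, HasDerivAt S (deriv S Z) Z := fun Z hZ =>
      ((hS.differentiableOn (by norm_num)).differentiableAt (Ioi_mem_nhds hZ)).hasDerivAt
    have hS' : ContDiffOn ℝ 1 (deriv S) (Set.Ioi (0 : ℝ)) :=
      ((contDiffOn_succ_iff_deriv_of_isOpen (n := 1) isOpen_Ioi).1
        (by simpa [one_add_one_eq_two] using hS)).2.2
    have hS2 : ∀ Z > 0, HasDerivAt (deriv S) (deriv (deriv S) Z) Z := fun Z hZ =>
      ((hS'.differentiableOn (by norm_num)).differentiableAt (Ioi_mem_nhds hZ)).hasDerivAt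
    obtain ⟨A, hA⟩ := aux_const (fun Z => Z * ((S Z - M₀ / (2 * Z₀)) * (2 * Z₀ / (Z + Z₀) ^ 2)
        - deriv S Z * ((Z - Z₀) / (Z + Z₀)))) (by
      intro Z hZ
      have hP : Z + Z₀ ≠ 0 := by positivity
      have e : deriv (deriv S) Z =
          ((M₀ - 2 * Z₀ * S Z) / (Z + Z₀) ^ 2 - deriv S Z) / Z := by
        rw [← h Z hZ]; field_simp; ring
      refine HasDerivAt.congr_deriv ((hasDerivAt_id Z).mul ((((hS1 Z hZ).sub_const (M₀ / (2 * Z₀))).mul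
        (aux_f2 Z₀ Z hZ₀ hZ)).sub ((hS2 Z hZ).mul (aux_f Z₀ Z hZ₀ hZ)))) ?_
      try simp only [id, Pi.mul_apply, Pi.sub_apply]
      rw [e]
      field_simp
      ring)
    obtain ⟨B, hB⟩ := aux_const (fun Z => Z * ((S Z - M₀ / (2 * Z₀)) *
        (2 * Z₀ / (Z + Z₀) ^ 2 * Real.log Z + (Z - Z₀) / (Z + Z₀) * Z⁻¹)
        - deriv S Z * ((Z - Z₀) / (Z + Z₀) * Real.log Z - 2))) (by
      intro Z hZ
      have hP : Z + Z₀ ≠ 0 := by positivity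
      have e : deriv (deriv S) Z =
          ((M₀ - 2 * Z₀ * S Z) / (Z + Z₀) ^ 2 - deriv S Z) / Z := by
        rw [← h Z hZ]; field_simp; ring
      have hl := Real.hasDerivAt_log hZ.ne'
      have hf := aux_f Z₀ Z hZ₀ hZ
      refine HasDerivAt.congr_deriv ((hasDerivAt_id Z).mul ((((hS1 Z hZ).sub_const (M₀ / (2 * Z₀))).mul
        (((aux_f2 Z₀ Z hZ₀ hZ).mul hl).add (hf.mul (hasDerivAt_inv hZ.ne')))).sub
        ((hS2 Z hZ).mul ((hf.mul hl).sub_const 2)))) ?_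
      try simp only [id, Pi.mul_apply, Pi.sub_apply, Pi.add_apply]
      rw [e]
      field_simp
      ring)
    refine ⟨M₀ / (2 * Z₀) + 2 * A, -B, -A, by field_simp; ring, fun Z hZ => ?_⟩
    have hP : Z + Z₀ ≠ 0 := by positivity
    rw [← hA Z hZ, ← hB Z hZ]
    field_simp
    ring
  · rintro ⟨C₀, α, C₂, hM, h⟩
    have d1 : ∀ Z > 0, deriv S Z = 2 * Z₀ / (Z + Z₀) ^ 2 * (-α + C₂ * Real.log Z)
        + (Z - Z₀) / (Z + Z₀) * (C₂ * Z⁻¹) := by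
      intro Z hZ
      have := ((aux_f Z₀ Z hZ₀ hZ).mul
        (((Real.hasDerivAt_log hZ.ne').const_mul C₂).const_add (-α))).const_add C₀
      refine (this.congr_of_eventuallyEq ?_).deriv
      filter_upwards [Ioi_mem_nhds hZ] with x hx using h x hx
    intro Z hZ
    have hP : Z + Z₀ ≠ 0 := by positivity
    have hl := ((Real.hasDerivAt_log hZ.ne').const_mul C₂).const_add (-α)
    have d2 := (((aux_f2 Z₀ Z hZ₀ hZ).mul hl).add ((aux_f Z₀ Z hZ₀ hZ).mul
      ((hasDerivAt_inv hZ.ne').const_mul C₂)))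
    have d3 := (d2.congr_of_eventuallyEq (f₁ := deriv S) (by
      filter_upwards [Ioi_mem_nhds hZ] with x hx using d1 x hx)).deriv
    rw [d3, d1 Z hZ, h Z hZ, ← hM]
    field_simp
    ring
end

section
/- Let a and e be real numbers, let U ⊆ ℝ³ be an open set on which z ≠ 0, and let r : U → ℝ be a differentiable function with r > 0 satisfying r⁴ − (x²+y²+z²−a²)·r² − a²z² = 0 on U. Define the complex vector field V : U → ℂ³ by V(x,y,z) = (e·r³/(r² + iaz)³)·(x, y, z + ia). Then V has vanishing divergence and vanishing curl on U: ∂V₁/∂x + ∂V₂/∂y + ∂V₃/∂z = 0 and ∂V₃/∂y − ∂V₂/∂z = 0, ∂V₁/∂z − ∂V₃/∂x = 0, ∂V₂/∂x − ∂V₁/∂y = 0 (all derivatives taken componentwise, with complex values). This expresses that the charged Kerr electromagnetic field satisfies the source-free Maxwell equations. -/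
open Complex

/-- The self-dual complex vector field of the charged Kerr electromagnetic
field: `V(x,y,z) = (e·r³/(r²+iaz)³)·(x, y, z+ia)`. -/
noncomputable def chargedKerrV (e a : ℝ) (r : ℝ × ℝ × ℝ → ℝ) (p : ℝ × ℝ × ℝ) :
    ℂ × ℂ × ℂ :=
  ((e : ℂ) * (r p : ℂ) ^ 3 / ((r p : ℂ) ^ 2 + (a : ℂ) * (p.2.2 : ℂ) * Complex.I) ^ 3 *
      (p.1 : ℂ),
   (e : ℂ) * (r p : ℂ) ^ 3 / ((r p : ℂ) ^ 2 + (a : ℂ) * (p.2.2 : ℂ) * Complex.I) ^ 3 *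
      (p.2.1 : ℂ),
   (e : ℂ) * (r p : ℂ) ^ 3 / ((r p : ℂ) ^ 2 + (a : ℂ) * (p.2.2 : ℂ) * Complex.I) ^ 3 *
      ((p.2.2 : ℂ) + (a : ℂ) * Complex.I))

/-- The key computation: `u = 1/w` with `w² = x² + y² + (z + ia)²`. -/
theorem kerr_key (a e : ℝ) (U : Set (ℝ × ℝ × ℝ)) (hU : IsOpen U)
    (r : ℝ × ℝ × ℝ → ℝ) (hrdiff : ∀ p ∈ U, DifferentiableAt ℝ r p)
    (hrpos : ∀ p ∈ U, 0 < r p)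
    (hreq : ∀ p ∈ U,
      r p ^ 4 - (p.1 ^ 2 + p.2.1 ^ 2 + p.2.2 ^ 2 - a ^ 2) * r p ^ 2 -
        a ^ 2 * p.2.2 ^ 2 = 0) (p : ℝ × ℝ × ℝ) (hp : p ∈ U) :
    ∃ u : ℂ, u ^ 2 * ((p.1 : ℂ) ^ 2 + (p.2.1 : ℂ) ^ 2 + ((p.2.2 : ℂ) + a * I) ^ 2) = 1 ∧
    (∀ v : ℝ × ℝ × ℝ,
      fderiv ℝ (fun q => (chargedKerrV e a r q).1) p v = e * (u ^ 3 * v.1 - 3 * u ^ 5 *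
        (p.1 * v.1 + p.2.1 * v.2.1 + (p.2.2 + a * I) * v.2.2) * p.1)) ∧
    (∀ v : ℝ × ℝ × ℝ,
      fderiv ℝ (fun q => (chargedKerrV e a r q).2.1) p v = e * (u ^ 3 * v.2.1 - 3 * u ^ 5 *
        (p.1 * v.1 + p.2.1 * v.2.1 + (p.2.2 + a * I) * v.2.2) * p.2.1)) ∧
    (∀ v : ℝ × ℝ × ℝ,
      fderiv ℝ (fun q => (chargedKerrV e a r q).2.2) p v = e * (u ^ 3 * v.2.2 - 3 * u ^ 5 *
        (p.1 * v.1 + p.2.1 * v.2.1 + (p.2.2 + a * I) * v.2.2) * (p.2.2 + a * I))) := by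
  have hne : ∀ q ∈ U, (r q : ℂ) ^ 2 + (a : ℂ) * (q.2.2 : ℂ) * I ≠ 0 := by
    intro q hq h
    have h1 := congrArg Complex.re h
    have h2 := hrpos q hq
    simp [pow_two] at h1
    exact h2.ne' h1
  let u : ℝ × ℝ × ℝ → ℂ := fun q => (r q : ℂ) / ((r q : ℂ) ^ 2 + (a : ℂ) * (q.2.2 : ℂ) * I)
  have hu : ∀ q ∈ U, u q ^ 2 *
      ((q.1 : ℂ) ^ 2 + (q.2.1 : ℂ) ^ 2 + ((q.2.2 : ℂ) + a * I) ^ 2) = 1 := by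
    intro q hq
    have h0 := hne q hq
    have h1 := congrArg (fun t : ℝ => (t : ℂ)) (hreq q hq)
    push_cast at h1
    simp only [u]
    rw [div_pow, div_mul_eq_mul_div, div_eq_one_iff_eq (pow_ne_zero 2 h0)]
    linear_combination (-1 : ℂ) * h1 + (a ^ 2 * r q ^ 2 - a ^ 2 * q.2.2 ^ 2 : ℂ) * I_sq
  let L1 : ℝ × ℝ × ℝ →L[ℝ] ℂ := ofRealCLM.comp (ContinuousLinearMap.fst ℝ ℝ (ℝ × ℝ))
  let L2 : ℝ × ℝ × ℝ →L[ℝ] ℂ := ofRealCLM.comp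
    ((ContinuousLinearMap.fst ℝ ℝ ℝ).comp (ContinuousLinearMap.snd ℝ ℝ (ℝ × ℝ)))
  let L3 : ℝ × ℝ × ℝ →L[ℝ] ℂ := ofRealCLM.comp
    ((ContinuousLinearMap.snd ℝ ℝ ℝ).comp (ContinuousLinearMap.snd ℝ ℝ (ℝ × ℝ)))
  have hL1 : HasFDerivAt (fun q : ℝ × ℝ × ℝ => (q.1 : ℂ)) L1 p := L1.hasFDerivAt
  have hL2 : HasFDerivAt (fun q : ℝ × ℝ × ℝ => (q.2.1 : ℂ)) L2 p := L2.hasFDerivAt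
  have hL3 : HasFDerivAt (fun q : ℝ × ℝ × ℝ => (q.2.2 : ℂ)) L3 p := L3.hasFDerivAt
  have hL3' : HasFDerivAt (fun q : ℝ × ℝ × ℝ => (q.2.2 : ℂ) + a * I) L3 p :=
    hL3.add_const _
  have hrC : DifferentiableAt ℝ (fun q => (r q : ℂ)) p :=
    ofRealCLM.differentiableAt.comp p (hrdiff p hp)
  have hud : DifferentiableAt ℝ u p := by
    have hd : DifferentiableAt ℝ
        (fun q : ℝ × ℝ × ℝ => (r q : ℂ) ^ 2 + (a : ℂ) * (q.2.2 : ℂ) * I) p :=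
      (hrC.pow 2).add ((hL3.differentiableAt.const_mul _).mul_const _)
    simp only [u, div_eq_mul_inv]
    exact hrC.mul (hd.inv (hne p hp))
  have hu' : HasFDerivAt u (fderiv ℝ u p) p := hud.hasFDerivAt
  have hN := hU.mem_nhds hp
  have hu0 : u p ≠ 0 := by
    intro h
    have := hu p hp
    rw [h] at this
    simp at this
  have hdu : ∀ v : ℝ × ℝ × ℝ, fderiv ℝ u p v =
      - u p ^ 3 * (p.1 * v.1 + p.2.1 * v.2.1 + (p.2.2 + a * I) * v.2.2) := by
    intro v
    have hA := (hu'.pow 2).mul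
      (((hL1.pow 2).add (hL2.pow 2)).add (hL3'.pow 2))
    have hB := hA.congr_of_eventuallyEq
      (f₁ := fun _ => (1 : ℂ)) (by filter_upwards [hN] with q hq using (hu q hq).symm)
    have hC := congrArg (fun M => M v) (hB.unique (hasFDerivAt_const (1 : ℂ) p))
    simp [L1, L2, L3] at hC
    have h1 := hu p hp
    have h2 : u p * (2 * (fderiv ℝ u p v +
      u p ^ 3 * (p.1 * v.1 + p.2.1 * v.2.1 + (p.2.2 + a * I) * v.2.2))) = 0 := by
      linear_combination u p ^ 2 * hC - 2 * u p * fderiv ℝ u p v * (h1)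
    have h3 := (mul_eq_zero.mp h2).resolve_left hu0
    linear_combination h3 / 2
  have hgen : ∀ (X : ℝ × ℝ × ℝ → ℂ) (L : ℝ × ℝ × ℝ →L[ℝ] ℂ), HasFDerivAt X L p →
      ∀ v : ℝ × ℝ × ℝ, fderiv ℝ (fun q => (e : ℂ) * (r q : ℂ) ^ 3 /
        ((r q : ℂ) ^ 2 + (a : ℂ) * (q.2.2 : ℂ) * Complex.I) ^ 3 * X q) p v =
        e * (u p ^ 3 * L v - 3 * u p ^ 5 *
        (p.1 * v.1 + p.2.1 * v.2.1 + (p.2.2 + a * I) * v.2.2) * X p) := by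
    intro X L hX v
    have hE : (fun q => (e : ℂ) * (r q : ℂ) ^ 3 /
        ((r q : ℂ) ^ 2 + (a : ℂ) * (q.2.2 : ℂ) * Complex.I) ^ 3 * X q) =
        fun q => (e : ℂ) * (u q ^ 3 * X q) := by
      funext q
      simp only [u, div_pow]
      ring
    rw [hE, (((hu'.pow 3).fun_mul hX).const_mul (e : ℂ)).fderiv]
    simp [hdu]
    ring
  exact ⟨u p, hu p hp, hgen _ L1 hL1, hgen _ L2 hL2, hgen _ L3 hL3'⟩

/-- On an open set `U ⊆ ℝ³` with `z ≠ 0`, where the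
differentiable function `r > 0` satisfies the Kerr defining quartic
`r⁴ − (x²+y²+z²−a²)r² − a²z² = 0`, the complex vector field
`V = (e·r³/(r²+iaz)³)·(x, y, z+ia)` has vanishing divergence and vanishing
curl (the source-free Maxwell equations for the charged Kerr field). -/
theorem stmt_14 (a e : ℝ) (U : Set (ℝ × ℝ × ℝ)) (hU : IsOpen U)
    (hz : ∀ p ∈ U, p.2.2 ≠ 0)
    (r : ℝ × ℝ × ℝ → ℝ) (hrdiff : ∀ p ∈ U, DifferentiableAt ℝ r p)
    (hrpos : ∀ p ∈ U, 0 < r p)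
    (hreq : ∀ p ∈ U,
      r p ^ 4 - (p.1 ^ 2 + p.2.1 ^ 2 + p.2.2 ^ 2 - a ^ 2) * r p ^ 2 -
        a ^ 2 * p.2.2 ^ 2 = 0) :
    ∀ p ∈ U,
      (fderiv ℝ (fun q => (chargedKerrV e a r q).1) p (1, 0, 0) +
        fderiv ℝ (fun q => (chargedKerrV e a r q).2.1) p (0, 1, 0) +
        fderiv ℝ (fun q => (chargedKerrV e a r q).2.2) p (0, 0, 1) = 0) ∧
      (fderiv ℝ (fun q => (chargedKerrV e a r q).2.2) p (0, 1, 0) -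
        fderiv ℝ (fun q => (chargedKerrV e a r q).2.1) p (0, 0, 1) = 0) ∧
      (fderiv ℝ (fun q => (chargedKerrV e a r q).1) p (0, 0, 1) -
        fderiv ℝ (fun q => (chargedKerrV e a r q).2.2) p (1, 0, 0) = 0) ∧
      (fderiv ℝ (fun q => (chargedKerrV e a r q).2.1) p (1, 0, 0) -
        fderiv ℝ (fun q => (chargedKerrV e a r q).1) p (0, 1, 0) = 0) := by
  intro p hp
  obtain ⟨u, h, h1, h2, h3⟩ := kerr_key a e U hU r hrdiff hrpos hreq p hp
  simp only [h1, h2, h3, ofReal_one, ofReal_zero]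
  refine ⟨?_, ?_, ?_, ?_⟩
  · linear_combination (-3 * e * u ^ 3 : ℂ) * h
  · ring
  · ring
  · ring
end

section
/- Fix real numbers m and a with a ≠ 0. For (x,y,z) ∈ ℝ³ with R = √(x²+y²+z²) > |a| and z ≠ 0, let r = r(x,y,z) > 0 be the unique positive root of r⁴ − (R²−a²)r² − a²z² = 0, let k be the 1-form k = dt + (z/r)dz + (r/(r²+a²))(x·dx + y·dy) − (a/(r²+a²))(x·dy − y·dx), let h = 2mr³/(r⁴+a²z²), and let dR = (x·dx + y·dy + z·dz)/R. Then, as R → ∞, every component of the symmetric 2-tensor h·k⊗k − [(2m/R)·(dt+dR)⊗(dt+dR) − (2ma/R³)·((x·dy − y·dx)⊗(dt+dR) + (dt+dR)⊗(x·dy − y·dx))] is O(R⁻³). That is, the Kerr metric agrees to this order with the linearized field of a body of mass m and angular momentum vector J = (0,0,ma). -/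
theorem aux_div_le (n d B R : ℝ) (k : ℕ) (hR : 0 < R) (hd : 0 < d) (h : |n| * R ^ k ≤ B * d) :
    |n / d| ≤ B / R ^ k := by
  rw [abs_div, abs_of_pos hd, div_le_div_iff₀ hd (by positivity)]
  exact h

theorem aux_comb (m A D H R h ki kj ei ej ui uj : ℝ) (hR : 1 ≤ R) (hA : 0 ≤ A) (hD : 0 ≤ D)
    (hH : 0 ≤ H)
    (hh : |h - 2 * m / R| ≤ H / R ^ 3)
    (hki : |ki - (ei - ui)| ≤ D / R ^ 2) (hkj : |kj - (ej - uj)| ≤ D / R ^ 2)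
    (hei : |ei| ≤ 1) (hej : |ej| ≤ 1) (hui : |ui| ≤ A / R) (huj : |uj| ≤ A / R) :
    |h * ki * kj - (2 * m / R * ei * ej - 2 * m / R * (ui * ej + ei * uj))| ≤
      (H * (1 + A + D) * (1 + A + D) + 2 * |m| * (A * A + D * (1 + A + D) + (1 + A) * D))
        / R ^ 3 := by
  have hR0 : 0 < R := by linarith
  have hA1 : A / R ≤ A := div_le_self hA hR
  have hD1 : D / R ^ 2 ≤ D := div_le_self hD (one_le_pow₀ hR)
  have key : ∀ k e u : ℝ, |k - (e - u)| ≤ D / R ^ 2 → |e| ≤ 1 → |u| ≤ A / R →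
      |e - u| ≤ 1 + A ∧ |k| ≤ 1 + A + D := by
    intro k e u h1 h2 h3
    rw [abs_le] at h1 h2 h3
    constructor
    · rw [abs_le]; constructor <;> linarith
    · rw [abs_le]; constructor <;> linarith
  obtain ⟨hi1, hi2⟩ := key _ _ _ hki hei hui
  obtain ⟨hj1, hj2⟩ := key _ _ _ hkj hej huj
  have e1 : h * ki * kj - (2 * m / R * ei * ej - 2 * m / R * (ui * ej + ei * uj)) =
      (h - 2 * m / R) * ki * kj +
      2 * m / R * (ui * uj + (ki - (ei - ui)) * kj + (ei - ui) * (kj - (ej - uj))) := by ring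
  rw [e1]
  have hm : |2 * m / R| = 2 * |m| / R := by
    rw [abs_div, abs_mul, abs_of_pos hR0, abs_of_pos (by norm_num : (0:ℝ) < 2)]
  calc _ ≤ |h - 2 * m / R| * |ki| * |kj| + |2 * m / R| *
          (|ui| * |uj| + |ki - (ei - ui)| * |kj| + |ei - ui| * |kj - (ej - uj)|) := by
        refine (abs_add_le _ _).trans ?_
        rw [abs_mul, abs_mul, abs_mul (2 * m / R), ← abs_mul ui, ← abs_mul (ki - (ei - ui)) kj,
          ← abs_mul (ei - ui)]
        gcongr
        exact (abs_add_le _ _).trans (add_le_add_left (abs_add_le _ _) _)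
    _ ≤ H / R ^ 3 * (1 + A + D) * (1 + A + D) + 2 * |m| / R *
          (A / R * (A / R) + D / R ^ 2 * (1 + A + D) + (1 + A) * (D / R ^ 2)) := by
        rw [hm]; gcongr
    _ = _ := by field_simp

set_option maxHeartbeats 1000000 in
/-- For fixed `m` and `a ≠ 0`, there are constants `C > 0` and
`R₀` such that for all `(x,y,z)` with `z ≠ 0`, `R = √(x²+y²+z²) ≥ R₀`, and `r`
the (unique) positive root of `r⁴ − (R²−a²)r² − a²z² = 0`, every component of
the symmetric 2-tensor
`h·k⊗k − [(2m/R)(dt+dR)⊗(dt+dR) − (2ma/R³)((xdy−ydx)⊗(dt+dR) + (dt+dR)⊗(xdy−ydx))]`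
is bounded by `C/R³`; i.e. the Kerr metric agrees to order `O(R⁻³)` with the
linearized field of a body of mass `m` and angular momentum `J = (0,0,ma)`. -/
theorem stmt_15 (m a : ℝ) (ha : a ≠ 0) :
    ∃ C R₀ : ℝ, 0 < C ∧
      ∀ x y z r : ℝ, z ≠ 0 → 0 < r →
        r ^ 4 - (x ^ 2 + y ^ 2 + z ^ 2 - a ^ 2) * r ^ 2 - a ^ 2 * z ^ 2 = 0 →
        R₀ ≤ Real.sqrt (x ^ 2 + y ^ 2 + z ^ 2) →
        (let R := Real.sqrt (x ^ 2 + y ^ 2 + z ^ 2)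
         let h := 2 * m * r ^ 3 / (r ^ 4 + a ^ 2 * z ^ 2)
         -- components of k = dt + (z/r)dz + (r/(r²+a²))(xdx+ydy) − (a/(r²+a²))(xdy−ydx)
         let kc : Fin 4 → ℝ :=
           ![r / (r ^ 2 + a ^ 2) * x + a / (r ^ 2 + a ^ 2) * y,
             r / (r ^ 2 + a ^ 2) * y - a / (r ^ 2 + a ^ 2) * x,
             z / r, 1]
         -- components of dt + dR, with dR = (xdx+ydy+zdz)/R
         let ec : Fin 4 → ℝ := ![x / R, y / R, z / R, 1]
         -- components of ω = xdy − ydx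
         let ωc : Fin 4 → ℝ := ![-y, x, 0, 0]
         ∀ i j : Fin 4,
           |h * kc i * kc j -
              ((2 * m / R) * ec i * ec j -
                (2 * m * a / R ^ 3) * (ωc i * ec j + ec i * ωc j))| ≤
             C / R ^ 3) := by
  set A := |a| with hA
  have hA0 : 0 ≤ A := abs_nonneg a
  have hA2 : A ^ 2 = a ^ 2 := sq_abs a
  set D := 2 * A ^ 2 + A ^ 3 with hD
  have hD0 : 0 ≤ D := by positivity
  set H := 4 * |m| * A ^ 2 with hH
  have hH0 : 0 ≤ H := by positivity
  refine ⟨(H * (1 + A + D) * (1 + A + D) + 2 * |m| * (A * A + D * (1 + A + D) + (1 + A) * D)) + 1,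
    2 * A + 1, by positivity, ?_⟩
  intro x y z r hz hr hroot hR0
  intro R h kc ec ωc i j
  have hRR : 2 * A + 1 ≤ R := hR0
  have hRsq : R ^ 2 = x ^ 2 + y ^ 2 + z ^ 2 := Real.sq_sqrt (by positivity)
  clear_value R
  have hR1 : 1 ≤ R := by linarith
  have hRpos : 0 < R := by linarith
  rw [← hRsq] at hroot
  have hz2 : z ^ 2 ≤ R ^ 2 := by linarith [sq_nonneg x, sq_nonneg y]
  have hx1 : |x| ≤ R := abs_le_of_sq_le_sq (by linarith [sq_nonneg z, sq_nonneg y]) hRpos.le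
  have hy1 : |y| ≤ R := abs_le_of_sq_le_sq (by linarith [sq_nonneg z, sq_nonneg x]) hRpos.le
  have hz1 : |z| ≤ R := abs_le_of_sq_le_sq hz2 hRpos.le
  have hr2 : 0 < r ^ 2 := by positivity
  have hlow : R ^ 2 ≤ r ^ 2 + a ^ 2 := by
    by_contra hc
    push Not at hc
    nlinarith [mul_pos hr2 (sub_pos.2 hc), mul_nonneg (sq_nonneg a) (sq_nonneg z)]
  have hup2 : r ^ 2 ≤ R ^ 2 := by
    by_contra hc
    push Not at hc
    nlinarith [mul_pos hr2 (sub_pos.2 hc),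
      mul_nonneg (sq_nonneg a) (sub_nonneg.2 (hz2.trans hc.le))]
  have hup : r ≤ R := (abs_le_of_sq_le_sq' hup2 hRpos.le).2
  have h34 : 3 / 4 * R ^ 2 ≤ r ^ 2 := by
    have : (2 * A) ^ 2 ≤ R ^ 2 := by
      gcongr
      linarith
    linarith [mul_pow 2 A 2]
  have hhalf : R ≤ 2 * r :=
    (abs_le_of_sq_le_sq' (by linarith [mul_pow 2 r 2]) (by positivity)).2
  have hdiff : R * (R - r) ≤ A ^ 2 := by nlinarith [mul_nonneg hr.le (sub_nonneg.2 hup)]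
  have hdiff' : r * (R - r) ≤ A ^ 2 :=
    (mul_le_mul_of_nonneg_right hup (sub_nonneg.2 hup)).trans hdiff
  have hdiff0 : 0 ≤ R - r := by linarith
  have hS : 0 < r ^ 2 + a ^ 2 := by positivity
  have B1 : |r / (r ^ 2 + a ^ 2) - 1 / R| ≤ A ^ 2 / R ^ 3 := by
    have : r / (r ^ 2 + a ^ 2) - 1 / R = (r * (R - r) - a ^ 2) / (R * (r ^ 2 + a ^ 2)) := by
      field_simp; ring
    rw [this]
    apply aux_div_le _ _ _ _ _ hRpos (by positivity)
    have h1 : |r * (R - r) - a ^ 2| ≤ A ^ 2 := by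
      rw [abs_le]; constructor <;> linarith [mul_nonneg hr.le hdiff0]
    have h2 : R ^ 3 ≤ R * (r ^ 2 + a ^ 2) := by
      calc R ^ 3 = R * R ^ 2 := by ring
        _ ≤ _ := by gcongr
    gcongr
  have B2 : |1 / (r ^ 2 + a ^ 2) - 1 / R ^ 2| ≤ A ^ 2 / R ^ 4 := by
    have : 1 / (r ^ 2 + a ^ 2) - 1 / R ^ 2 =
        (R ^ 2 - (r ^ 2 + a ^ 2)) / (R ^ 2 * (r ^ 2 + a ^ 2)) := by
      field_simp
    rw [this]
    apply aux_div_le _ _ _ _ _ hRpos (by positivity)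
    have h1 : |R ^ 2 - (r ^ 2 + a ^ 2)| ≤ A ^ 2 := by
      rw [abs_le]; constructor <;> linarith
    have h2 : R ^ 4 ≤ R ^ 2 * (r ^ 2 + a ^ 2) := by
      calc R ^ 4 = R ^ 2 * R ^ 2 := by ring
        _ ≤ _ := by gcongr
    gcongr
  have B3 : |1 / r - 1 / R| ≤ 2 * A ^ 2 / R ^ 3 := by
    have : 1 / r - 1 / R = (R - r) / (r * R) := by
      field_simp
    rw [this]
    apply aux_div_le _ _ _ _ _ hRpos (by positivity)
    rw [abs_of_nonneg hdiff0]
    calc (R - r) * R ^ 3 = R * (R - r) * R * R := by ring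
      _ ≤ A ^ 2 * (2 * r) * R := by gcongr
      _ = _ := by ring
  have B4 : |h - 2 * m / R| ≤ H / R ^ 3 := by
    have hden : 0 < r ^ 4 + a ^ 2 * z ^ 2 := by positivity
    have : h - 2 * m / R =
        2 * m * (r ^ 3 * (R - r) - a ^ 2 * z ^ 2) / (R * (r ^ 4 + a ^ 2 * z ^ 2)) := by
      simp only [h]
      field_simp; ring
    rw [this]
    apply aux_div_le _ _ _ _ _ hRpos (by positivity)
    have h1 : |r ^ 3 * (R - r) - a ^ 2 * z ^ 2| ≤ A ^ 2 * R ^ 2 := by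
      have t1 : r ^ 3 * (R - r) ≤ A ^ 2 * R ^ 2 := by
        calc r ^ 3 * (R - r) = r * (R - r) * r ^ 2 := by ring
          _ ≤ _ := by gcongr
      have t2 : a ^ 2 * z ^ 2 ≤ A ^ 2 * R ^ 2 := by rw [hA2]; gcongr
      have t3 : 0 ≤ r ^ 3 * (R - r) := by positivity
      have t4 : 0 ≤ a ^ 2 * z ^ 2 := by positivity
      rw [abs_le]; constructor <;> linarith
    have h2 : R ^ 4 ≤ 2 * (r ^ 4 + a ^ 2 * z ^ 2) := by
      have t4 : 0 ≤ a ^ 2 * z ^ 2 := by positivity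
      nlinarith [mul_self_le_mul_self (by positivity) h34, sq_nonneg (R ^ 2)]
    rw [abs_mul, abs_mul, abs_of_pos (by norm_num : (0:ℝ) < 2)]
    calc 2 * |m| * |r ^ 3 * (R - r) - a ^ 2 * z ^ 2| * R ^ 3
        ≤ 2 * |m| * (A ^ 2 * R ^ 2) * R ^ 3 := by gcongr
      _ = 2 * |m| * A ^ 2 * R * R ^ 4 := by ring
      _ ≤ 2 * |m| * A ^ 2 * R * (2 * (r ^ 4 + a ^ 2 * z ^ 2)) := by gcongr
      _ = _ := by rw [hH]; ring
  have hxy : ∀ s t : ℝ, |s| ≤ R → |t| ≤ R →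
      |s * (r / (r ^ 2 + a ^ 2) - 1 / R) + a * t * (1 / (r ^ 2 + a ^ 2) - 1 / R ^ 2)| ≤
        D / R ^ 2 := by
    intro s t hs ht
    calc _ ≤ |s| * |r / (r ^ 2 + a ^ 2) - 1 / R| +
          |a| * |t| * |1 / (r ^ 2 + a ^ 2) - 1 / R ^ 2| := by
          refine (abs_add_le _ _).trans ?_
          rw [abs_mul, abs_mul, abs_mul]
      _ ≤ R * (A ^ 2 / R ^ 3) + A * R * (A ^ 2 / R ^ 4) := by gcongr
      _ = (A ^ 2 + A ^ 3 / R) / R ^ 2 := by field_simp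
      _ ≤ D / R ^ 2 := by
          have : A ^ 3 / R ≤ A ^ 3 := div_le_self (by positivity) hR1
          gcongr
          rw [hD]; linarith [sq_nonneg A]
  have hk : ∀ i, |kc i - (ec i - a / R ^ 2 * ωc i)| ≤ D / R ^ 2 := by
    intro i
    fin_cases i
    · convert hxy x y hx1 hy1 using 2
      simp [kc, ec, ωc]; ring
    · convert hxy y (-x) hy1 (by rwa [abs_neg]) using 2
      simp [kc, ec, ωc]; ring
    · have e : kc 2 - (ec 2 - a / R ^ 2 * ωc 2) = z * (1 / r - 1 / R) := by
        simp [kc, ec, ωc]; ring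
      change |kc 2 - (ec 2 - a / R ^ 2 * ωc 2)| ≤ _
      rw [e, abs_mul]
      calc _ ≤ R * (2 * A ^ 2 / R ^ 3) := by gcongr
        _ = 2 * A ^ 2 / R ^ 2 := by field_simp
        _ ≤ _ := by
          gcongr
          rw [hD]; linarith [pow_nonneg hA0 3]
    · simp [kc, ec, ωc]; positivity
  have he : ∀ i, |ec i| ≤ 1 := by
    intro i
    have q : ∀ s : ℝ, |s| ≤ R → |s / R| ≤ 1 := by
      intro s hs
      rw [abs_div, abs_of_pos hRpos]
      exact (div_le_one hRpos).2 hs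
    fin_cases i
    · exact q x hx1
    · exact q y hy1
    · exact q z hz1
    · simp [ec]
  have hu : ∀ i, |a / R ^ 2 * ωc i| ≤ A / R := by
    intro i
    have q : |ωc i| ≤ R := by
      fin_cases i
      · simpa [ωc] using hy1
      · simpa [ωc] using hx1
      · simpa [ωc] using hRpos.le
      · simpa [ωc] using hRpos.le
    rw [abs_mul, abs_div, abs_of_pos (by positivity : 0 < R ^ 2)]
    calc _ ≤ A / R ^ 2 * R := by gcongr
      _ = _ := by field_simp
  have fin := aux_comb m A D H R h (kc i) (kc j) (ec i) (ec j) _ _ hR1 hA0 hD0 hH0 B4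
    (hk i) (hk j) (he i) (he j) (hu i) (hu j)
  have e : h * kc i * kc j - ((2 * m / R) * ec i * ec j -
      (2 * m * a / R ^ 3) * (ωc i * ec j + ec i * ωc j)) =
      h * kc i * kc j - (2 * m / R * ec i * ec j -
        2 * m / R * (a / R ^ 2 * ωc i * ec j + ec i * (a / R ^ 2 * ωc j))) := by
    field_simp
  rw [e]
  refine fin.trans ?_
  exact div_le_div_of_nonneg_right (le_add_of_nonneg_right zero_le_one) (by positivity)
end
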